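/- The function r(x) = ρ(x) − x is strictly decreasing on ℝ. -/

import Mathlib

/-- Standard normal density. -/
noncomputable def stdPhi (x : ℝ) : ℝ := Real.exp (-x ^ 2 / 2) / Real.sqrt (2 * Real.pi)

/-- Standard normal upper-tail probability. -/
noncomputable def phiBar (x : ℝ) : ℝ := ∫ t in Set.Ioi x, stdPhi t

/-- Standard normal hazard rate. -/
noncomputable def rho (x : ℝ) : ℝ := stdPhi x / phiBar x

/-- The difference r(x) = ρ(x) − x. -/
noncomputable def rFun (x : ℝ) : ℝ := rho x - x

/-- Ψ(x) = −log Φ̄(x). -/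
noncomputable def Psi (x : ℝ) : ℝ := -Real.log (phiBar x)

lemma stdPhi_pos (x : ℝ) : 0 < stdPhi x := by
  unfold stdPhi; positivity

lemma hasDerivAt_stdPhi (x : ℝ) : HasDerivAt stdPhi (-x * stdPhi x) x := by
  have h : HasDerivAt (fun y : ℝ => -y ^ 2 / 2) (-x) x := by
    convert! ((hasDerivAt_pow 2 x).neg.div_const 2) using 1
    norm_num
    ring
  unfold stdPhi
  convert! h.exp.div_const (Real.sqrt (2 * Real.pi)) using 1
  ring

lemma continuous_stdPhi : Continuous stdPhi :=
  continuous_iff_continuousAt.2 fun x => (hasDerivAt_stdPhi x).continuousAt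

lemma integrable_pow_mul_stdPhi (n : ℕ) :
    MeasureTheory.Integrable fun t : ℝ => t ^ n * stdPhi t := by
  have h := integrable_rpow_mul_exp_neg_mul_sq (b := 1 / 2) (by norm_num)
    (s := n) (by have : (0 : ℝ) ≤ n := n.cast_nonneg
                 linarith)
  refine (h.div_const (Real.sqrt (2 * Real.pi))).congr (Filter.Eventually.of_forall fun t => ?_)
  simp only [stdPhi, Real.rpow_natCast]
  rw [show -(1 / 2 : ℝ) * t ^ 2 = -t ^ 2 / 2 by ring, mul_div_assoc]

lemma integrable_stdPhi : MeasureTheory.Integrable stdPhi := by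
  simpa using integrable_pow_mul_stdPhi 0

lemma integrable_quadratic_mul_stdPhi (a b c : ℝ) :
    MeasureTheory.Integrable fun t : ℝ => (a * t ^ 2 + b * t + c) * stdPhi t := by
  convert! (((integrable_pow_mul_stdPhi 2).const_mul a).add
    ((integrable_pow_mul_stdPhi 1).const_mul b)).add
    ((integrable_pow_mul_stdPhi 0).const_mul c) using 1
  · ext t
    simp only [Pi.add_apply]
    ring

lemma setIntegral_Ioi_pos_of_ae_pos {f : ℝ → ℝ} {x : ℝ}
    (hf : MeasureTheory.IntegrableOn f (Set.Ioi x)) (h0 : ∀ t, 0 ≤ f t)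
    (hpos : ∀ᵐ t, f t ≠ 0) : 0 < ∫ t in Set.Ioi x, f t := by
  rw [MeasureTheory.setIntegral_pos_iff_support_of_nonneg_ae
    (Filter.Eventually.of_forall h0) hf, Set.inter_comm,
    MeasureTheory.measure_inter_conull (t := Function.support f) (MeasureTheory.ae_iff.1 hpos)]
  simp

lemma phiBar_pos (x : ℝ) : 0 < phiBar x :=
  setIntegral_Ioi_pos_of_ae_pos integrable_stdPhi.integrableOn (fun t => (stdPhi_pos t).le)
    (Filter.Eventually.of_forall fun t => (stdPhi_pos t).ne')

lemma hasDerivAt_phiBar (x : ℝ) : HasDerivAt phiBar (-stdPhi x) x := by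
  have h : phiBar = fun y => phiBar 0 - ∫ t in (0 : ℝ)..y, stdPhi t := by
    ext y
    rw [phiBar, phiBar, ← intervalIntegral.integral_interval_add_Ioi
      (integrable_stdPhi.integrableOn (s := Set.Ioi 0))
      (integrable_stdPhi.integrableOn (s := Set.Ioi y))]
    ring
  rw [h]
  exact (intervalIntegral.integral_hasDerivAt_right
    (continuous_stdPhi.intervalIntegrable _ _)
    (continuous_stdPhi.stronglyMeasurableAtFilter _ _)
    continuous_stdPhi.continuousAt).const_sub _

lemma integral_Ioi_sub_sq_mul_stdPhi (m x : ℝ) :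
    ∫ t in Set.Ioi x, (t - m) ^ 2 * stdPhi t =
      (x - 2 * m) * stdPhi x + (1 + m ^ 2) * phiBar x := by
  have hderiv : ∀ t, HasDerivAt (fun t => (2 * m - t) * stdPhi t)
      ((1 * t ^ 2 + (-2 * m) * t + (-1)) * stdPhi t) t := fun t => by
    convert! ((hasDerivAt_id t).const_sub (2 * m)).mul (hasDerivAt_stdPhi t) using 1
    simp only [id]
    ring
  have hint := (integrable_quadratic_mul_stdPhi 1 (-2 * m) (-1)).integrableOn (s := Set.Ioi x)
  have hint' : MeasureTheory.IntegrableOn (fun t => (2 * m - t) * stdPhi t) (Set.Ioi x) := by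
    convert! (integrable_quadratic_mul_stdPhi 0 (-1) (2 * m)).integrableOn using 2
    ring
  have hlim := MeasureTheory.tendsto_zero_of_hasDerivAt_of_integrableOn_Ioi
    (fun t _ => hderiv t) hint hint'
  have hftc := MeasureTheory.integral_Ioi_of_hasDerivAt_of_tendsto'
    (fun t _ => hderiv t) hint hlim
  have hsplit : (fun t => (t - m) ^ 2 * stdPhi t) = fun t =>
      (1 * t ^ 2 + (-2 * m) * t + (-1)) * stdPhi t + (1 + m ^ 2) * stdPhi t := by
    ext t
    ring
  rw [hsplit, MeasureTheory.integral_add hint (integrable_stdPhi.integrableOn.const_mul _),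
    hftc, MeasureTheory.integral_const_mul, phiBar]
  ring

/-- Positivity of the variance of the standard normal law conditioned on exceeding `x`. -/
lemma rho_mul_rho_sub_lt_one (x : ℝ) : rho x * (rho x - x) < 1 := by
  have hpos : 0 < ∫ t in Set.Ioi x, (t - rho x) ^ 2 * stdPhi t := by
    refine setIntegral_Ioi_pos_of_ae_pos ?_
      (fun t => mul_nonneg (sq_nonneg _) (stdPhi_pos t).le) ?_
    · convert! (integrable_quadratic_mul_stdPhi 1 (-2 * rho x) (rho x ^ 2)).integrableOn using 2
      ring
    · filter_upwards [MeasureTheory.Measure.ae_ne MeasureTheory.volume (rho x)] with t ht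
      exact mul_ne_zero (pow_ne_zero 2 (sub_ne_zero.2 ht)) (stdPhi_pos t).ne'
  rw [integral_Ioi_sub_sq_mul_stdPhi] at hpos
  have hphi : stdPhi x = rho x * phiBar x := by
    rw [rho, div_mul_cancel₀ _ (phiBar_pos x).ne']
  rw [hphi] at hpos
  have : 0 < (1 - rho x * (rho x - x)) * phiBar x := by linarith
  linarith [pos_of_mul_pos_left this (phiBar_pos x).le]

lemma hasDerivAt_rFun (x : ℝ) : HasDerivAt rFun (rho x * (rho x - x) - 1) x := by
  have hne := (phiBar_pos x).ne'
  convert! ((hasDerivAt_stdPhi x).div (hasDerivAt_phiBar x) hne).sub (hasDerivAt_id x) using 1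
  rw [rho]
  field_simp
  ring

theorem rFun_strictAnti : StrictAnti rFun := by
  refine strictAnti_of_hasDerivAt_neg hasDerivAt_rFun fun x => ?_
  linarith [rho_mul_rho_sub_lt_one x]
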